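/- arXiv:0706.0664 — 7 statements merged into one kernel-verified Lean document; each statement's English description precedes it below -/
import Mathlib

section
/- (Proposition 2, uniqueness.) Let c₁, c₂ > 0, t₁ ∈ (0,1), q ∈ (0,1) and s ≥ 1 be real numbers. Suppose x₁, x₂, z₁, z₂ ∈ ℝ with x₁ + x₂ > 0 satisfy, for i = 1, 2, the equations [1 − q·t₁ − q·s·t₁·(xᵢ/(x₁+x₂) − zᵢ)]·[1/(x₁+x₂) − xᵢ/(x₁+x₂)²] − cᵢ = 0 and −(1−q)·t₁ + q·s·t₁·(xᵢ/(x₁+x₂) − zᵢ) = 0. Then x₁ = c₂(1−t₁)/(c₁+c₂)², x₂ = c₁(1−t₁)/(c₁+c₂)², z₁ = c₂/(c₁+c₂) − (1−q)/(q·s) and z₂ = c₁/(c₁+c₂) − (1−q)/(q·s). -/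
theorem first_order_equations_unique_solution
    (c₁ c₂ t₁ q s : ℝ) (hc₁ : 0 < c₁) (hc₂ : 0 < c₂)
    (ht₁ : t₁ ∈ Set.Ioo (0 : ℝ) 1) (hq : q ∈ Set.Ioo (0 : ℝ) 1) (hs : 1 ≤ s)
    (x₁ x₂ z₁ z₂ : ℝ) (hpos : 0 < x₁ + x₂)
    (h1 : (1 - q * t₁ - q * s * t₁ * (x₁ / (x₁ + x₂) - z₁)) *
        (1 / (x₁ + x₂) - x₁ / (x₁ + x₂) ^ 2) - c₁ = 0)
    (h2 : (1 - q * t₁ - q * s * t₁ * (x₂ / (x₁ + x₂) - z₂)) *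
        (1 / (x₁ + x₂) - x₂ / (x₁ + x₂) ^ 2) - c₂ = 0)
    (h3 : -(1 - q) * t₁ + q * s * t₁ * (x₁ / (x₁ + x₂) - z₁) = 0)
    (h4 : -(1 - q) * t₁ + q * s * t₁ * (x₂ / (x₁ + x₂) - z₂) = 0) :
    x₁ = c₂ * (1 - t₁) / (c₁ + c₂) ^ 2 ∧
    x₂ = c₁ * (1 - t₁) / (c₁ + c₂) ^ 2 ∧
    z₁ = c₂ / (c₁ + c₂) - (1 - q) / (q * s) ∧
    z₂ = c₁ / (c₁ + c₂) - (1 - q) / (q * s) := by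
  obtain ⟨ht0, ht1⟩ := ht₁
  obtain ⟨hq0, hq1⟩ := hq
  have hs0 : 0 < s := by linarith
  have e1 : 1 - q * t₁ - q * s * t₁ * (x₁ / (x₁ + x₂) - z₁) = 1 - t₁ := by linarith
  have e2 : 1 - q * t₁ - q * s * t₁ * (x₂ / (x₁ + x₂) - z₂) = 1 - t₁ := by linarith
  rw [e1] at h1
  rw [e2] at h2
  have k3 : x₁ / (x₁ + x₂) - z₁ = (1 - q) / (q * s) := by
    rw [eq_div_iff (by positivity)]
    apply mul_left_cancel₀ ht0.ne'
    linarith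
  have k4 : x₂ / (x₁ + x₂) - z₂ = (1 - q) / (q * s) := by
    rw [eq_div_iff (by positivity)]
    apply mul_left_cancel₀ ht0.ne'
    linarith
  clear h3 h4 e1 e2
  obtain ⟨S, hS⟩ : ∃ S, S = x₁ + x₂ := ⟨_, rfl⟩
  rw [← hS] at hpos h1 h2 k3 k4
  have hS0 : S ≠ 0 := hpos.ne'
  have hc : c₁ + c₂ ≠ 0 := by positivity
  have a1 : (1 - t₁) * x₂ = c₁ * S ^ 2 := by
    have hx : x₂ = S - x₁ := by linarith
    rw [hx]
    field_simp at h1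
    linarith
  have a2 : (1 - t₁) * x₁ = c₂ * S ^ 2 := by
    have hx : x₁ = S - x₂ := by linarith
    rw [hx]
    field_simp at h2
    linarith
  have a3 : 1 - t₁ = (c₁ + c₂) * S := by
    apply mul_right_cancel₀ hS0
    linear_combination a1 + a2 + (1 - t₁) * hS
  rw [a3] at a1 a2
  have b1 : x₁ * (c₁ + c₂) = c₂ * S := by
    apply mul_right_cancel₀ hS0
    linarith
  have b2 : x₂ * (c₁ + c₂) = c₁ * S := by
    apply mul_right_cancel₀ hS0
    linarith
  have d1 : x₁ / S = c₂ / (c₁ + c₂) := by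
    rw [div_eq_div_iff hS0 hc, b1]
  have d2 : x₂ / S = c₁ / (c₁ + c₂) := by
    rw [div_eq_div_iff hS0 hc, b2]
  refine ⟨?_, ?_, by linarith, by linarith⟩
  · rw [eq_div_iff (by positivity), a3]
    linear_combination (c₁ + c₂) * b1
  · rw [eq_div_iff (by positivity), a3]
    linear_combination (c₁ + c₂) * b2
end

section
/- (Feasibility of the stationary state.) Let c₁, c₂ > 0, t₁ ∈ (0,1), q ∈ (0,1) and s ≥ 1 be real numbers with q·s + q − 1 > 0, and assume (1−q)·c₁/(q·s+q−1) ≤ c₂ ≤ (q·s+q−1)·c₁/(1−q). Then x₁* > 0, x₂* > 0, 0 ≤ z₁* ≤ x₁*/(x₁*+x₂*) and 0 ≤ z₂* ≤ x₂*/(x₁*+x₂*); in particular the declared revenues zᵢ* do not exceed the true tax bases xᵢ*·p(x₁*+x₂*) with p(x) = 1/x. -/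
theorem stationary_state_feasible
    (c₁ c₂ t₁ q s : ℝ) (hc₁ : 0 < c₁) (hc₂ : 0 < c₂)
    (ht₁ : t₁ ∈ Set.Ioo (0 : ℝ) 1) (hq : q ∈ Set.Ioo (0 : ℝ) 1) (hs : 1 ≤ s)
    (hqs : 0 < q * s + q - 1)
    (hlow : (1 - q) * c₁ / (q * s + q - 1) ≤ c₂)
    (hhigh : c₂ ≤ (q * s + q - 1) * c₁ / (1 - q)) :
    let x₁s := c₂ * (1 - t₁) / (c₁ + c₂) ^ 2
    let x₂s := c₁ * (1 - t₁) / (c₁ + c₂) ^ 2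
    let z₁s := c₂ / (c₁ + c₂) - (1 - q) / (q * s)
    let z₂s := c₁ / (c₁ + c₂) - (1 - q) / (q * s)
    0 < x₁s ∧ 0 < x₂s ∧
    (0 ≤ z₁s ∧ z₁s ≤ x₁s / (x₁s + x₂s)) ∧
    (0 ≤ z₂s ∧ z₂s ≤ x₂s / (x₁s + x₂s)) := by
  obtain ⟨_, ht⟩ := ht₁
  obtain ⟨hq0, hq1⟩ := hq
  have h1t : 0 < 1 - t₁ := by linarith
  have h1q : 0 < 1 - q := by linarith
  have hS : 0 < c₁ + c₂ := by linarith
  have hqs0 : 0 < q * s := mul_pos hq0 (by linarith)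
  rw [div_le_iff₀ hqs] at hlow
  rw [le_div_iff₀ h1q] at hhigh
  have hpos : 0 < (1 - q) / (q * s) := div_pos h1q hqs0
  intro x₁s x₂s z₁s z₂s
  have e1 : x₁s / (x₁s + x₂s) = c₂ / (c₁ + c₂) := by
    simp only [x₁s, x₂s]
    rw [← add_div, ← add_mul, add_comm c₂ c₁]
    field_simp
  have e2 : x₂s / (x₁s + x₂s) = c₁ / (c₁ + c₂) := by
    simp only [x₁s, x₂s]
    rw [← add_div, ← add_mul, add_comm c₂ c₁]
    field_simp
  rw [e1, e2]
  refine ⟨by positivity, by positivity, ⟨?_, by simp only [z₁s]; linarith⟩,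
    ⟨?_, by simp only [z₂s]; linarith⟩⟩
  · simp only [z₁s]
    rw [sub_nonneg, div_le_div_iff₀ hqs0 hS]
    nlinarith
  · simp only [z₂s]
    rw [sub_nonneg, div_le_div_iff₀ hqs0 hS]
    nlinarith
end

section
/- (Routh–Hurwitz criterion for a quartic.) Let m₃, m₂, m₁, m₀ be real numbers, and set D₁ = m₃, D₂ = m₃·m₂ − m₁, D₃ = m₁·D₂ − m₃²·m₀. Then every complex root λ of the polynomial λ⁴ + m₃λ³ + m₂λ² + m₁λ + m₀ has negative real part if and only if D₁ > 0, D₂ > 0, D₃ > 0 and m₀ > 0. -/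
open Polynomial in
theorem rh_root4 (a b c d : ℂ) : ∃ z : ℂ, z ^ 4 + a * z ^ 3 + b * z ^ 2 + c * z + d = 0 := by
  have hd : (X ^ 4 + C a * X ^ 3 + C b * X ^ 2 + C c * X + C d : ℂ[X]).degree = 4 := by
    compute_degree!
  obtain ⟨z, hz⟩ := IsAlgClosed.exists_root
    (X ^ 4 + C a * X ^ 3 + C b * X ^ 2 + C c * X + C d : ℂ[X]) (by rw [hd]; decide)
  exact ⟨z, by simpa [IsRoot] using hz⟩

open Polynomial in
theorem rh_root3 (b c d : ℂ) : ∃ z : ℂ, z ^ 3 + b * z ^ 2 + c * z + d = 0 := by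
  have hd : (X ^ 3 + C b * X ^ 2 + C c * X + C d : ℂ[X]).degree = 3 := by
    compute_degree!
  obtain ⟨z, hz⟩ := IsAlgClosed.exists_root
    (X ^ 3 + C b * X ^ 2 + C c * X + C d : ℂ[X]) (by rw [hd]; decide)
  exact ⟨z, by simpa [IsRoot] using hz⟩

open Polynomial in
theorem rh_root2 (c d : ℂ) : ∃ z : ℂ, z ^ 2 + c * z + d = 0 := by
  have hd : (X ^ 2 + C c * X + C d : ℂ[X]).degree = 2 := by
    compute_degree!
  obtain ⟨z, hz⟩ := IsAlgClosed.exists_root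
    (X ^ 2 + C c * X + C d : ℂ[X]) (by rw [hd]; decide)
  exact ⟨z, by simpa [IsRoot] using hz⟩

theorem rh_lin (z : ℂ) (hz : z.im ≠ 0) (A B : ℝ) (h : (A : ℂ) * z + B = 0) : A = 0 ∧ B = 0 := by
  have h1 := congrArg Complex.im h
  have h2 := congrArg Complex.re h
  simp at h1 h2
  have hA : A = 0 := by tauto
  subst hA
  simpa using h2

theorem rh_quad (z : ℂ) :
    z ^ 2 + ((-2 * z.re : ℝ) : ℂ) * z + ((z.re ^ 2 + z.im ^ 2 : ℝ) : ℂ) = 0 := by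
  apply Complex.ext <;> simp [pow_two] <;> ring

theorem rh_real (z : ℂ) (h : z.im = 0) : z = (z.re : ℂ) := by
  apply Complex.ext <;> simp [h]

theorem rh_fac3 (p q r : ℝ) : ∃ s a b : ℝ, p = a + s ∧ q = b + a * s ∧ r = b * s := by
  obtain ⟨z, hz⟩ := rh_root3 p q r
  by_cases h : z.im = 0
  · rw [rh_real z h] at hz
    generalize z.re = x at hz
    norm_cast at hz
    refine ⟨-x, p + x, q + (p + x) * x, by ring, by ring, by linear_combination hz⟩
  · have hq := rh_quad z
    generalize -2 * z.re = a at hq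
    generalize z.re ^ 2 + z.im ^ 2 = b at hq
    obtain ⟨h1, h2⟩ := rh_lin z h (q - b - a * (p - a)) (r - b * (p - a)) (by
      push_cast
      linear_combination hz - (z + (p - a)) * hq)
    exact ⟨p - a, a, b, by ring, by linear_combination h1, by linear_combination h2⟩

theorem rh_fac4 (m₃ m₂ m₁ m₀ : ℝ) : ∃ a b c d : ℝ,
    m₃ = a + c ∧ m₂ = b + d + a * c ∧ m₁ = a * d + b * c ∧ m₀ = b * d := by
  obtain ⟨z, hz⟩ := rh_root4 m₃ m₂ m₁ m₀
  by_cases h : z.im = 0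
  · rw [rh_real z h] at hz
    generalize z.re = x at hz
    norm_cast at hz
    obtain ⟨s, a, b, h1, h2, h3⟩ := rh_fac3 (m₃ + x) (m₂ + (m₃ + x) * x)
      (m₁ + (m₂ + (m₃ + x) * x) * x)
    refine ⟨a, b, s - x, -x * s, by linear_combination h1, by linear_combination h2 - x * h1,
      by linear_combination h3 - x * h2, by linear_combination hz - x * h3⟩
  · have hq := rh_quad z
    generalize -2 * z.re = a at hq
    generalize z.re ^ 2 + z.im ^ 2 = b at hq
    obtain ⟨h1, h2⟩ := rh_lin z h
      (m₁ - a * (m₂ - b - a * (m₃ - a)) - b * (m₃ - a))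
      (m₀ - b * (m₂ - b - a * (m₃ - a))) (by
      push_cast
      linear_combination hz - (z ^ 2 + (m₃ - a) * z + (m₂ - b - a * (m₃ - a))) * hq)
    exact ⟨a, b, m₃ - a, m₂ - b - a * (m₃ - a), by ring, by ring,
      by linear_combination h1, by linear_combination h2⟩

theorem rh_stable2 (a b : ℝ) :
    (∀ z : ℂ, z ^ 2 + (a : ℂ) * z + (b : ℂ) = 0 → z.re < 0) ↔ 0 < a ∧ 0 < b := by
  constructor
  · intro H
    obtain ⟨z, hz⟩ := rh_root2 a b
    have h1 := H z hz
    have h2 := H (-a - z) (by linear_combination hz)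
    have hr := congrArg Complex.re hz
    have hi := congrArg Complex.im hz
    simp [pow_two] at h2 hr hi
    refine ⟨by linarith, ?_⟩
    by_cases h : z.im = 0
    · rw [h] at hr
      nlinarith
    · have : a = -2 * z.re := by
        apply mul_right_cancel₀ h
        linear_combination hi
      subst this
      have := sq_nonneg z.im
      nlinarith [mul_pos_of_neg_of_neg h1 h1]
  · rintro ⟨ha, hb⟩ z hz
    have hr := congrArg Complex.re hz
    have hi := congrArg Complex.im hz
    simp [pow_two] at hr hi
    by_contra! hx
    by_cases h : z.im = 0
    · rw [h] at hr
      nlinarith [mul_nonneg ha.le hx, mul_nonneg hx hx]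
    · have : a = -2 * z.re := by
        apply mul_right_cancel₀ h
        linear_combination hi
      linarith

theorem routh_hurwitz_quartic
    (m₃ m₂ m₁ m₀ : ℝ) :
    (∀ lam : ℂ, lam ^ 4 + (m₃ : ℂ) * lam ^ 3 + (m₂ : ℂ) * lam ^ 2 +
        (m₁ : ℂ) * lam + (m₀ : ℂ) = 0 → lam.re < 0) ↔
    (m₃ > 0 ∧ m₃ * m₂ - m₁ > 0 ∧
      m₁ * (m₃ * m₂ - m₁) - m₃ ^ 2 * m₀ > 0 ∧ m₀ > 0) := by
  obtain ⟨a, b, c, d, rfl, rfl, rfl, rfl⟩ := rh_fac4 m₃ m₂ m₁ m₀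
  have key : (a * d + b * c) * ((a + c) * (b + d + a * c) - (a * d + b * c))
      - (a + c) ^ 2 * (b * d) = (a * c) * ((b - d) ^ 2 + (a + c) * (a * d + b * c)) := by ring
  have key2 : (a + c) * (b + d + a * c) - (a * d + b * c)
      = a * b + c * d + a * c * (a + c) := by ring
  have fac : ∀ z : ℂ, z ^ 4 + ((a + c : ℝ) : ℂ) * z ^ 3 + ((b + d + a * c : ℝ) : ℂ) * z ^ 2 +
        ((a * d + b * c : ℝ) : ℂ) * z + ((b * d : ℝ) : ℂ)
        = (z ^ 2 + a * z + b) * (z ^ 2 + c * z + d) := by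
    intro z; push_cast; ring
  simp only [fac, mul_eq_zero, or_imp, forall_and, rh_stable2]
  constructor
  · rintro ⟨⟨ha, hb⟩, hc, hd⟩
    rw [key, key2]
    refine ⟨by positivity, by positivity, by positivity, by positivity⟩
  · rintro ⟨h1, h2, h3, h4⟩
    have h5 : 0 < a * d + b * c := by
      have : 0 < (a + c) ^ 2 * (b * d) := by positivity
      exact pos_of_mul_pos_left (by linarith) h2.le
    rw [key] at h3
    have h6 : 0 < a * c := by
      refine pos_of_mul_pos_left h3 ?_
      positivity
    have aux : 0 < a ∧ 0 < c := by
      rcases pos_and_pos_or_neg_and_neg_of_mul_pos h6 with h | h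
      · exact h
      · linarith [h.1, h.2]
    obtain ⟨ha, hc⟩ := aux
    rcases pos_and_pos_or_neg_and_neg_of_mul_pos h4 with h | h
    · exact ⟨⟨ha, h.1⟩, hc, h.2⟩
    · nlinarith [mul_pos_of_neg_of_neg h.1 h.2, mul_neg_of_pos_of_neg ha h.2, mul_neg_of_pos_of_neg hc h.1]
end

section
/- (Necessary condition for a purely imaginary characteristic root.) Let n₄₃, n₄₂, n₄₁, n₄₀, n₂₂, n₂₁, n₂₀, ω, τ be real numbers, and suppose (iω)⁴ + n₄₃(iω)³ + n₄₂(iω)² + n₄₁(iω) + n₄₀ + e^{−iωτ}·(n₂₂(iω)² + n₂₁(iω) + n₂₀) = 0 in ℂ. Then ω⁸ + r₆ω⁶ + r₄ω⁴ + r₂ω² + r₀ = 0, where r₆ = n₄₃² − 2n₄₂, r₄ = n₄₂² + 2n₄₀ − 2n₄₃n₄₁ − n₂₂², r₂ = n₄₁² − 2n₄₂n₄₀ + 2n₂₂n₂₀ − n₂₁², r₀ = n₄₀² − n₂₀². -/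
theorem purely_imaginary_root_necessary_condition
    (n₄₃ n₄₂ n₄₁ n₄₀ n₂₂ n₂₁ n₂₀ ω τ : ℝ)
    (h : (Complex.I * ω) ^ 4 + (n₄₃ : ℂ) * (Complex.I * ω) ^ 3 +
        (n₄₂ : ℂ) * (Complex.I * ω) ^ 2 + (n₄₁ : ℂ) * (Complex.I * ω) + (n₄₀ : ℂ) +
        Complex.exp (-(Complex.I * ω) * τ) *
          ((n₂₂ : ℂ) * (Complex.I * ω) ^ 2 + (n₂₁ : ℂ) * (Complex.I * ω) + (n₂₀ : ℂ)) = 0) :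
    ω ^ 8 + (n₄₃ ^ 2 - 2 * n₄₂) * ω ^ 6 +
      (n₄₂ ^ 2 + 2 * n₄₀ - 2 * n₄₃ * n₄₁ - n₂₂ ^ 2) * ω ^ 4 +
      (n₄₁ ^ 2 - 2 * n₄₂ * n₄₀ + 2 * n₂₂ * n₂₀ - n₂₁ ^ 2) * ω ^ 2 +
      (n₄₀ ^ 2 - n₂₀ ^ 2) = 0 := by
  have hP : (Complex.I * ω) ^ 4 + (n₄₃ : ℂ) * (Complex.I * ω) ^ 3 +
        (n₄₂ : ℂ) * (Complex.I * ω) ^ 2 + (n₄₁ : ℂ) * (Complex.I * ω) + (n₄₀ : ℂ) =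
      ((ω ^ 4 - n₄₂ * ω ^ 2 + n₄₀ : ℝ) : ℂ) + ((n₄₁ * ω - n₄₃ * ω ^ 3 : ℝ) : ℂ) * Complex.I := by
    push_cast
    simp only [mul_pow, Complex.I_sq, Complex.I_pow_three, Complex.I_pow_four]
    ring
  have hQ : (n₂₂ : ℂ) * (Complex.I * ω) ^ 2 + (n₂₁ : ℂ) * (Complex.I * ω) + (n₂₀ : ℂ) =
      ((n₂₀ - n₂₂ * ω ^ 2 : ℝ) : ℂ) + ((n₂₁ * ω : ℝ) : ℂ) * Complex.I := by
    push_cast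
    simp only [mul_pow, Complex.I_sq]
    ring
  have hE : Complex.normSq (Complex.exp (-(Complex.I * ω) * τ)) = 1 := by
    rw [Complex.normSq_eq_norm_sq, Complex.norm_exp]
    simp
  rw [hP, hQ] at h
  have h2 := congrArg Complex.normSq (eq_neg_of_add_eq_zero_left h)
  rw [Complex.normSq_neg, Complex.normSq_mul, hE, Complex.normSq_add_mul_I,
    Complex.normSq_add_mul_I] at h2
  linear_combination h2
end

section
/- (Existence of a critical delay.) Let n₄₃, n₄₂, n₄₁, n₄₀, n₂₂, n₂₁, n₂₀ be real numbers, and let ω₀ > 0 satisfy ω₀⁸ + r₆ω₀⁶ + r₄ω₀⁴ + r₂ω₀² + r₀ = 0, where r₆ = n₄₃² − 2n₄₂, r₄ = n₄₂² + 2n₄₀ − 2n₄₃n₄₁ − n₂₂², r₂ = n₄₁² − 2n₄₂n₄₀ + 2n₂₂n₂₀ − n₂₁², r₀ = n₄₀² − n₂₀². Assume (n₂₀ − n₂₂ω₀²)² + n₂₁²ω₀² ≠ 0. Then there exists a real number τ₀ ≥ 0 such that (iω₀)⁴ + n₄₃(iω₀)³ + n₄₂(iω₀)² + n₄₁(iω₀)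 + n₄₀ + e^{−iω₀τ₀}·(n₂₂(iω₀)² + n₂₁(iω₀) + n₂₀) = 0. -/
theorem aux_phase (P Q : ℂ) (w : ℝ) (hw : 0 < w) (hQ : Q ≠ 0)
    (h : Complex.normSq P = Complex.normSq Q) :
    ∃ t : ℝ, 0 ≤ t ∧ P + Complex.exp (-(Complex.I * w) * t) * Q = 0 := by
  have hz : ‖-P / Q‖ = 1 := by
    have h1 : ‖P‖ = ‖Q‖ := by
      rw [Complex.normSq_eq_norm_sq, Complex.normSq_eq_norm_sq] at h
      exact (sq_eq_sq₀ (norm_nonneg _) (norm_nonneg _)).1 h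
    rw [norm_div, norm_neg, h1]
    exact div_self (norm_ne_zero_iff.2 hQ)
  refine ⟨(2 * Real.pi - Complex.arg (-P / Q)) / w, ?_, ?_⟩
  · apply div_nonneg _ hw.le
    linarith [Complex.arg_le_pi (-P / Q), Real.pi_pos]
  · have hwc : (w : ℂ) ≠ 0 := by exact_mod_cast hw.ne'
    have e : -(Complex.I * w) * (((2 * Real.pi - Complex.arg (-P / Q)) / w : ℝ) : ℂ)
        = Complex.arg (-P / Q) * Complex.I - 2 * Real.pi * Complex.I := by
      push_cast
      field_simp
      ring
    have h2 := Complex.norm_mul_exp_arg_mul_I (-P / Q)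
    rw [hz, Complex.ofReal_one, one_mul] at h2
    rw [e, Complex.exp_sub, Complex.exp_two_pi_mul_I, div_one, h2]
    field_simp
    ring

theorem exists_critical_delay
    (n₄₃ n₄₂ n₄₁ n₄₀ n₂₂ n₂₁ n₂₀ ω₀ : ℝ) (hω₀ : 0 < ω₀)
    (hroot : ω₀ ^ 8 + (n₄₃ ^ 2 - 2 * n₄₂) * ω₀ ^ 6 +
      (n₄₂ ^ 2 + 2 * n₄₀ - 2 * n₄₃ * n₄₁ - n₂₂ ^ 2) * ω₀ ^ 4 +
      (n₄₁ ^ 2 - 2 * n₄₂ * n₄₀ + 2 * n₂₂ * n₂₀ - n₂₁ ^ 2) * ω₀ ^ 2 +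
      (n₄₀ ^ 2 - n₂₀ ^ 2) = 0)
    (hne : (n₂₀ - n₂₂ * ω₀ ^ 2) ^ 2 + n₂₁ ^ 2 * ω₀ ^ 2 ≠ 0) :
    ∃ τ₀ : ℝ, 0 ≤ τ₀ ∧
      (Complex.I * ω₀) ^ 4 + (n₄₃ : ℂ) * (Complex.I * ω₀) ^ 3 +
        (n₄₂ : ℂ) * (Complex.I * ω₀) ^ 2 + (n₄₁ : ℂ) * (Complex.I * ω₀) + (n₄₀ : ℂ) +
        Complex.exp (-(Complex.I * ω₀) * τ₀) *
          ((n₂₂ : ℂ) * (Complex.I * ω₀) ^ 2 + (n₂₁ : ℂ) * (Complex.I * ω₀) + (n₂₀ : ℂ)) = 0 := by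
  have hP : (Complex.I * ω₀) ^ 4 + (n₄₃ : ℂ) * (Complex.I * ω₀) ^ 3 +
        (n₄₂ : ℂ) * (Complex.I * ω₀) ^ 2 + (n₄₁ : ℂ) * (Complex.I * ω₀) + (n₄₀ : ℂ)
      = ((ω₀ ^ 4 - n₄₂ * ω₀ ^ 2 + n₄₀ : ℝ) : ℂ) + ((n₄₁ * ω₀ - n₄₃ * ω₀ ^ 3 : ℝ) : ℂ) * Complex.I := by
    have h3 : Complex.I ^ 3 = -Complex.I := Complex.I_pow_three
    simp only [mul_pow, Complex.I_sq, Complex.I_pow_four, h3]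
    push_cast
    ring
  have hQ : (n₂₂ : ℂ) * (Complex.I * ω₀) ^ 2 + (n₂₁ : ℂ) * (Complex.I * ω₀) + (n₂₀ : ℂ)
      = ((n₂₀ - n₂₂ * ω₀ ^ 2 : ℝ) : ℂ) + ((n₂₁ * ω₀ : ℝ) : ℂ) * Complex.I := by
    simp only [mul_pow, Complex.I_sq]
    push_cast
    ring
  rw [hP, hQ]
  apply aux_phase _ _ _ hω₀
  · rw [← Complex.normSq_pos, Complex.normSq_add_mul_I]
    apply lt_of_le_of_ne (by positivity)
    rw [mul_pow]
    exact hne.symm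
  · rw [Complex.normSq_add_mul_I, Complex.normSq_add_mul_I]
    linear_combination hroot
end

section
/- (Formula for the critical delay.) Let n₄₃, n₄₂, n₄₁, n₄₀, n₂₂, n₂₁, n₂₀ be real numbers, ω₀ > 0 and τ₀ ∈ ℝ, and suppose (iω₀)⁴ + n₄₃(iω₀)³ + n₄₂(iω₀)² + n₄₁(iω₀) + n₄₀ + e^{−iω₀τ₀}·(n₂₂(iω₀)² + n₂₁(iω₀) + n₂₀) = 0. Set a₁ = ω₀⁴ − n₄₂ω₀² + n₄₀, a₂ = −n₄₃ω₀³ + n₄₁ω₀, a₃ = n₂₂ω₀² − n₂₀, a₄ = n₂₁ω₀. If a₂a₄ − a₁a₃ ≠ 0 and cos(ω₀τ₀) ≠ 0, then tan(ω₀τ₀) = (a₁a₄ + a₂a₃)/(a₂a₄ − a₁a₃). -/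
theorem tan_formula_critical_delay
    (n₄₃ n₄₂ n₄₁ n₄₀ n₂₂ n₂₁ n₂₀ ω₀ τ₀ : ℝ) (hω₀ : 0 < ω₀)
    (h : (Complex.I * ω₀) ^ 4 + (n₄₃ : ℂ) * (Complex.I * ω₀) ^ 3 +
        (n₄₂ : ℂ) * (Complex.I * ω₀) ^ 2 + (n₄₁ : ℂ) * (Complex.I * ω₀) + (n₄₀ : ℂ) +
        Complex.exp (-(Complex.I * ω₀) * τ₀) *
          ((n₂₂ : ℂ) * (Complex.I * ω₀) ^ 2 + (n₂₁ : ℂ) * (Complex.I * ω₀) + (n₂₀ : ℂ)) = 0)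
    (a₁ : ℝ) (ha₁ : a₁ = ω₀ ^ 4 - n₄₂ * ω₀ ^ 2 + n₄₀)
    (a₂ : ℝ) (ha₂ : a₂ = -n₄₃ * ω₀ ^ 3 + n₄₁ * ω₀)
    (a₃ : ℝ) (ha₃ : a₃ = n₂₂ * ω₀ ^ 2 - n₂₀)
    (a₄ : ℝ) (ha₄ : a₄ = n₂₁ * ω₀)
    (hden : a₂ * a₄ - a₁ * a₃ ≠ 0)
    (hcos : Real.cos (ω₀ * τ₀) ≠ 0) :
    Real.tan (ω₀ * τ₀) = (a₁ * a₄ + a₂ * a₃) / (a₂ * a₄ - a₁ * a₃) := by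
  have hexp : Complex.exp (-(Complex.I * ω₀) * τ₀) =
      (Real.cos (ω₀ * τ₀) : ℂ) - (Real.sin (ω₀ * τ₀) : ℂ) * Complex.I := by
    have e : -(Complex.I * ω₀) * τ₀ = (-((ω₀ * τ₀ : ℝ) : ℂ)) * Complex.I := by
      push_cast; ring
    rw [e, Complex.exp_mul_I, Complex.cos_neg, Complex.sin_neg, Complex.ofReal_cos,
      Complex.ofReal_sin]
    ring
  rw [hexp] at h
  rw [Real.tan_eq_sin_div_cos, div_eq_div_iff hcos hden]
  generalize Real.cos (ω₀ * τ₀) = c at *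
  generalize Real.sin (ω₀ * τ₀) = s at *
  have I2 : Complex.I ^ 2 = -1 := Complex.I_sq
  have h' : ((a₁ - c * a₃ + s * a₄ : ℝ) : ℂ) + ((a₂ + c * a₄ + s * a₃ : ℝ) : ℂ) * Complex.I
      = 0 := by
    rw [← h, ha₁, ha₂, ha₃, ha₄]
    have I3 : Complex.I ^ 3 = -Complex.I := by rw [pow_succ, I2]; ring
    have I4 : Complex.I ^ 4 = 1 := Complex.I_pow_four
    push_cast
    ring_nf
    rw [I2, I3, I4]
    ring
  have E1 : a₁ - c * a₃ + s * a₄ = 0 := by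
    simpa using congrArg Complex.re h'
  have E2 : a₂ + c * a₄ + s * a₃ = 0 := by
    simpa using congrArg Complex.im h'
  linear_combination (-s * a₃ - c * a₄) * E1 + (s * a₄ - c * a₃) * E2
end

section
/- (Theorem 1(ii), absence of imaginary characteristic roots.) Let n₄₃, n₄₂, n₄₁, n₄₀, n₂₂, n₂₁, n₂₀ be real numbers. Set r₆ = n₄₃² − 2n₄₂, r₄ = n₄₂² + 2n₄₀ − 2n₄₃n₄₁ − n₂₂², r₂ = n₄₁² − 2n₄₂n₄₀ + 2n₂₂n₂₀ − n₂₁², r₀ = n₄₀² − n₂₀². Suppose that there is no real u > 0 with u⁴ + r₆u³ + r₄u² + r₂u + r₀ = 0, and that n₄₀ + n₂₀ ≠ 0. Then for every real τ and every real ω, λ = iω is not a root of the characteristic equation, i.e. (iω)⁴ + n₄₃(iω)³ + n₄₂(iω)² + n₄₁(iω) + n₄₀ + e^{−iωτ}·(n₂₂(iω)² + n₂₁(iω) + n₂₀) ≠ 0. -/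
theorem no_purely_imaginary_roots
    (n₄₃ n₄₂ n₄₁ n₄₀ n₂₂ n₂₁ n₂₀ : ℝ)
    (hnoroot : ¬ ∃ u : ℝ, 0 < u ∧
      u ^ 4 + (n₄₃ ^ 2 - 2 * n₄₂) * u ^ 3 +
        (n₄₂ ^ 2 + 2 * n₄₀ - 2 * n₄₃ * n₄₁ - n₂₂ ^ 2) * u ^ 2 +
        (n₄₁ ^ 2 - 2 * n₄₂ * n₄₀ + 2 * n₂₂ * n₂₀ - n₂₁ ^ 2) * u +
        (n₄₀ ^ 2 - n₂₀ ^ 2) = 0)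
    (hsum : n₄₀ + n₂₀ ≠ 0) :
    ∀ τ ω : ℝ,
      (Complex.I * ω) ^ 4 + (n₄₃ : ℂ) * (Complex.I * ω) ^ 3 +
        (n₄₂ : ℂ) * (Complex.I * ω) ^ 2 + (n₄₁ : ℂ) * (Complex.I * ω) + (n₄₀ : ℂ) +
        Complex.exp (-(Complex.I * ω) * τ) *
          ((n₂₂ : ℂ) * (Complex.I * ω) ^ 2 + (n₂₁ : ℂ) * (Complex.I * ω) + (n₂₀ : ℂ)) ≠ 0 := by
  intro τ ω h
  by_cases hω : ω = 0
  · subst hω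
    apply hsum
    have h' : ((n₄₀ + n₂₀ : ℝ) : ℂ) = 0 := by
      push_cast
      simpa using h
    exact_mod_cast h'
  · apply hnoroot
    refine ⟨ω ^ 2, by positivity, ?_⟩
    have hP : (Complex.I * ω) ^ 4 + (n₄₃ : ℂ) * (Complex.I * ω) ^ 3 +
        (n₄₂ : ℂ) * (Complex.I * ω) ^ 2 + (n₄₁ : ℂ) * (Complex.I * ω) + (n₄₀ : ℂ) =
        ((ω ^ 4 - n₄₂ * ω ^ 2 + n₄₀ : ℝ) : ℂ) +
          ((n₄₁ * ω - n₄₃ * ω ^ 3 : ℝ) : ℂ) * Complex.I := by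
      push_cast
      simp only [mul_pow, Complex.I_sq, Complex.I_pow_three, Complex.I_pow_four]
      ring
    have hQ : (n₂₂ : ℂ) * (Complex.I * ω) ^ 2 + (n₂₁ : ℂ) * (Complex.I * ω) + (n₂₀ : ℂ) =
        ((n₂₀ - n₂₂ * ω ^ 2 : ℝ) : ℂ) + ((n₂₁ * ω : ℝ) : ℂ) * Complex.I := by
      push_cast
      simp only [mul_pow, Complex.I_sq]
      ring
    have hE : Complex.normSq (Complex.exp (-(Complex.I * ω) * τ)) = 1 := by
      rw [Complex.normSq_eq_norm_sq, Complex.norm_exp]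
      simp
    rw [hP, hQ] at h
    have h2 := congrArg Complex.normSq (eq_neg_of_add_eq_zero_left h)
    rw [Complex.normSq_neg, Complex.normSq_mul, hE, one_mul,
      Complex.normSq_add_mul_I, Complex.normSq_add_mul_I] at h2
    linear_combination h2
end
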